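/- For every (T,φ) ∈ OP_Γ, the dimension of the affine span of the face F(T,φ) of the Voronoi polytope Vor_Γ equals b₁(Γ) − b₁(Γ∖T). -/

import Mathlib

/-!
Serre-style finite graphs: a vertex type `V`, an oriented-edge type `E` with a
fixed-point-free involution `inv` (edge reversal) and source/target maps `s, t`
with `s (inv e) = t e`.  An unoriented edge is an `inv`-orbit `{e, inv e}`;
subsets of unoriented edges are encoded as `inv`-closed subsets of `E`, and an
orientation of a spanning subgraph `Γ∖T` is encoded by the set `O` of its
positively oriented edges.  1-chains with coefficients in `A` are encoded as
functions `c : E → A` with `c (inv e) = - c e` (so that `(c, e⃗) = c e` for the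
standard bilinear form).
-/

structure SerreGraph where
  V : Type
  E : Type
  [fintypeV : Fintype V]
  [fintypeE : Fintype E]
  [decEqV : DecidableEq V]
  [decEqE : DecidableEq E]
  inv : E → E
  s : E → V
  t : E → V
  inv_inv : ∀ e, inv (inv e) = e
  inv_ne : ∀ e, inv e ≠ e
  s_inv : ∀ e, s (inv e) = t e

attribute [instance] SerreGraph.fintypeV SerreGraph.fintypeE
attribute [instance] SerreGraph.decEqV SerreGraph.decEqE

namespace SerreGraph

variable (Γ : SerreGraph)

/-- Reachability between vertices in the spanning subgraph whose allowed oriented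
edges are those in `A`. -/
def Reach (A : Set Γ.E) : Γ.V → Γ.V → Prop :=
  Relation.ReflTransGen (fun a b => ∃ e ∈ A, Γ.s e = a ∧ Γ.t e = b)

/-- The number of connected components of the spanning subgraph with allowed
oriented edges `A`. -/
noncomputable def numComponents (A : Set Γ.E) : ℕ :=
  Nat.card (Quot (fun a b : Γ.V => ∃ e ∈ A, Γ.s e = a ∧ Γ.t e = b))

/-- The set of separating (oriented) edges: removing the underlying unoriented
edge increases the number of connected components. -/
def Esep : Set Γ.E :=
  {e | Γ.numComponents Set.univ < Γ.numComponents {f | f ≠ e ∧ f ≠ Γ.inv e}}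

/-- `T` encodes a set of unoriented edges. -/
def InvClosed (T : Set Γ.E) : Prop := ∀ e, e ∈ T ↔ Γ.inv e ∈ T

/-- `O` is (the set of positively oriented edges of) an orientation of `Γ∖T`. -/
def IsOrientation (T O : Set Γ.E) : Prop :=
  (∀ e ∈ O, e ∉ T) ∧ ∀ e, e ∉ T → (e ∈ O ↔ Γ.inv e ∉ O)

/-- A totally cyclic orientation of `Γ∖T`: an orientation such that there is no
vertex set `W` which is nonempty and proper inside some connected component of
`Γ∖T` and such that all edges of `Γ∖T` crossing the boundary of `W` are oriented
out of `W` (this is the componentwise condition of the paper). -/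
def IsTotallyCyclic (T O : Set Γ.E) : Prop :=
  Γ.IsOrientation T O ∧
    ¬ ∃ W : Set Γ.V, (∃ v ∈ W, ∃ w ∈ Wᶜ, Γ.Reach Tᶜ v w) ∧
        ∀ e ∈ O, Γ.t e ∈ W → Γ.s e ∈ W

/-- `γ` is (the set of positively oriented edges of) an oriented circuit of `Γ`:
a cyclic subgraph (connected, first Betti number one, no separating edges)
together with a totally cyclic orientation; equivalently a directed cycle:
each incident vertex has exactly one outgoing and one incoming edge in `γ`,
and the support is connected. -/
def IsCircuit (γ : Finset Γ.E) : Prop :=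
  γ.Nonempty ∧ (∀ e ∈ γ, Γ.inv e ∉ γ) ∧
    (∀ v ∈ γ.image Γ.s ∪ γ.image Γ.t, ∃! e, e ∈ γ ∧ Γ.s e = v) ∧
    (∀ v ∈ γ.image Γ.s ∪ γ.image Γ.t, ∃! e, e ∈ γ ∧ Γ.t e = v) ∧
    ∀ e ∈ γ, ∀ f ∈ γ, Γ.Reach ((↑γ : Set Γ.E) ∪ Γ.inv '' ↑γ) (Γ.s e) (Γ.s f)

/-- The class `[γ] ∈ H₁(Γ,ℤ)` of an oriented circuit. -/
def circChainZ (γ : Finset Γ.E) : Γ.E → ℤ :=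
  fun e => if e ∈ γ then 1 else if Γ.inv e ∈ γ then -1 else 0

/-- The class `[γ] ∈ H₁(Γ,ℝ)` of an oriented circuit. -/
noncomputable def circChainR (γ : Finset Γ.E) : Γ.E → ℝ :=
  fun e => (Γ.circChainZ γ e : ℝ)

/-- `Cir_φ(Γ∖T)`: oriented circuits of `Γ∖T` compatibly oriented with the
orientation with positive edges `O`. -/
def Cir (T O : Set Γ.E) : Set (Finset Γ.E) :=
  {γ | Γ.IsCircuit γ ∧ (∀ e ∈ γ, e ∈ O) ∧ ∀ e ∈ γ, e ∉ T}

/-- `c` is a 1-cycle: a skew 1-chain with vanishing boundary, i.e. an element of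
`H₁(Γ,A)`. -/
def IsCycle {A : Type*} [AddCommGroup A] (c : Γ.E → A) : Prop :=
  (∀ e, c (Γ.inv e) = - c e) ∧
    ∀ v, ∑ e ∈ Finset.univ.filter (fun e => Γ.t e = v), c e = 0

/-- An element of `H₁(Γ∖T, A) ⊆ H₁(Γ,A)`: a cycle supported on edges not in `T`. -/
def IsCycleOn {A : Type*} [AddCommGroup A] (T : Set Γ.E) (c : Γ.E → A) : Prop :=
  Γ.IsCycle c ∧ ∀ e ∈ T, c e = 0

/-- The standard positive definite bilinear form on `C⃗₁(Γ,ℝ)`, for which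
`(c, e⃗) = c e`. -/
noncomputable def pair (c c' : Γ.E → ℝ) : ℝ := (∑ e, c e * c' e) / 2

/-- The first Betti number `b₁(Γ) = dim_ℝ H₁(Γ,ℝ)`. -/
noncomputable def b1 : ℕ :=
  Module.finrank ℝ (Submodule.span ℝ {c : Γ.E → ℝ | Γ.IsCycle c})

/-- `b₁(Γ∖T) = dim_ℝ H₁(Γ∖T,ℝ)`. -/
noncomputable def b1Sub (T : Set Γ.E) : ℕ :=
  Module.finrank ℝ (Submodule.span ℝ {c : Γ.E → ℝ | Γ.IsCycleOn T c})

/-- The cone `σ(T,φ) ⊆ H₁(Γ,ℝ)` of the cographic fan associated to a pair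
`(T, O)` with `O` an orientation of `Γ∖T`. -/
def sigmaCone (T O : Set Γ.E) : Set (Γ.E → ℝ) :=
  {v | Γ.IsCycle v ∧ (∀ e ∈ O, 0 ≤ v e) ∧ ∀ e ∈ T, v e = 0}

/-- The poset `OP_Γ` of totally cyclic orientations: pairs `(T, O)` with `T` a
set of unoriented edges and `O` a totally cyclic orientation of `Γ∖T`. -/
def OP : Set (Set Γ.E × Set Γ.E) :=
  {p | Γ.InvClosed p.1 ∧ Γ.IsTotallyCyclic p.1 p.2}

/-- The order on `OP_Γ`: `(T',φ') ≤ (T,φ)` iff `T' ⊇ T` and `φ'` is the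
restriction of `φ`. -/
def OPle (p q : Set Γ.E × Set Γ.E) : Prop :=
  q.1 ⊆ p.1 ∧ p.2 = q.2 ∩ p.1ᶜ

/-- `H₁(Γ,ℤ)` viewed as the set of lattice points of `H₁(Γ,ℝ)`. -/
def H1Z : Set (Γ.E → ℝ) := {c | Γ.IsCycle c ∧ ∀ e, ∃ n : ℤ, c e = (n : ℝ)}

/-- The Voronoi polytope `Vor_Γ ⊆ H₁(Γ,ℝ)`. -/
def voronoi : Set (Γ.E → ℝ) :=
  {v | Γ.IsCycle v ∧ ∀ l ∈ Γ.H1Z, Γ.pair v v ≤ Γ.pair (v - l) (v - l)}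

/-- A (exposed) face of the Voronoi polytope. -/
def IsVorFace (F : Set (Γ.E → ℝ)) : Prop :=
  ∃ l : (Γ.E → ℝ) →ₗ[ℝ] ℝ, F = {v | v ∈ Γ.voronoi ∧ ∀ w ∈ Γ.voronoi, l w ≤ l v}

/-- The face `F(T,φ)` of the Voronoi polytope associated to `(T,O) ∈ OP_Γ`. -/
def vorFace (T O : Set Γ.E) : Set (Γ.E → ℝ) :=
  {v | v ∈ Γ.voronoi ∧ ∀ γ ∈ Γ.Cir T O,
      Γ.pair v (Γ.circChainR γ) = Γ.pair (Γ.circChainR γ) (Γ.circChainR γ) / 2}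

end SerreGraph

/-- Over the standard dot product, a subspace `D` of `H` whose orthogonal complement in `H` is `K`
has dimension complementary to that of `K`. -/
theorem finrank_eq_sub_of_dotProduct {ι : Type*} [Fintype ι] {H K D : Submodule ℝ (ι → ℝ)}
    (hDH : D ≤ H) (hKH : K ≤ H) (hDK : ∀ d ∈ D, ∀ k ∈ K, d ⬝ᵥ k = 0)
    (hmax : ∀ h ∈ H, (∀ d ∈ D, d ⬝ᵥ h = 0) → h ∈ K) :
    Module.finrank ℝ D = Module.finrank ℝ H - Module.finrank ℝ K := by
  let L := (WithLp.linearEquiv 2 ℝ (ι → ℝ)).symm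
  have hL : ∀ x y : ι → ℝ, inner ℝ (L x) (L y) = x ⬝ᵥ y := fun x y => by
    simp [L, PiLp.inner_apply, dotProduct, mul_comm]
  have hfin : ∀ S : Submodule ℝ (ι → ℝ),
      Module.finrank ℝ (S.map L.toLinearMap) = Module.finrank ℝ S := fun S =>
    LinearEquiv.finrank_map_eq L S
  have key : (D.map L.toLinearMap)ᗮ ⊓ H.map L.toLinearMap = K.map L.toLinearMap := by
    ext x
    constructor
    · rintro ⟨hx, h, hh, rfl⟩
      refine ⟨h, hmax h hh fun d hd => ?_, rfl⟩
      rw [← hL]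
      exact (Submodule.mem_orthogonal _ _).1 hx _ ⟨d, hd, rfl⟩
    · rintro ⟨k, hk, rfl⟩
      refine ⟨(Submodule.mem_orthogonal _ _).2 ?_, k, hKH hk, rfl⟩
      rintro _ ⟨d, hd, rfl⟩
      exact (hL d k).trans (hDK d hd k hk)
  have := Submodule.finrank_add_inf_finrank_orthogonal
    (Submodule.map_mono (f := L.toLinearMap) hDH)
  rw [key, hfin, hfin, hfin] at this
  omega

theorem exists_mem_dotProduct_eq {ι : Type*} [Fintype ι] (H : Submodule ℝ (ι → ℝ)) (c : ι → ℝ) :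
    ∃ v ∈ H, ∀ h ∈ H, v ⬝ᵥ h = c ⬝ᵥ h := by
  let L := (WithLp.linearEquiv 2 ℝ (ι → ℝ)).symm
  have hL : ∀ x y : ι → ℝ, inner ℝ (L x) (L y) = x ⬝ᵥ y := fun x y => by
    simp [L, PiLp.inner_apply, dotProduct, mul_comm]
  obtain ⟨v, hv, hvc⟩ := ((H.map L.toLinearMap).starProjection_apply_mem (L c))
  refine ⟨v, hv, fun h hh => ?_⟩
  have := Submodule.starProjection_inner_eq_zero (K := H.map L.toLinearMap) (L c) (L h) ⟨h, hh, rfl⟩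
  rw [← hvc, inner_sub_left] at this
  rw [← hL, ← hL]
  exact (sub_eq_zero.1 this).symm

namespace SerreGraph

variable (Γ : SerreGraph)

theorem t_inv (e : Γ.E) : Γ.t (Γ.inv e) = Γ.s e := by
  rw [← Γ.s_inv, Γ.inv_inv]

theorem pair_eq_dotProduct (c d : Γ.E → ℝ) : Γ.pair c d = c ⬝ᵥ d / 2 := rfl

/-- `H₁(Γ∖T, ℝ)` as a submodule. -/
def cyclesOn (T : Set Γ.E) : Submodule ℝ (Γ.E → ℝ) where
  carrier := {c | Γ.IsCycleOn T c}
  zero_mem' := ⟨⟨by simp, by simp⟩, by simp⟩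
  add_mem' := by
    rintro a b ⟨⟨ha, ha'⟩, ha''⟩ ⟨⟨hb, hb'⟩, hb''⟩
    refine ⟨⟨fun e => ?_, fun v => ?_⟩, fun e he => ?_⟩
    · simp [ha, hb, add_comm]
    · simp [Finset.sum_add_distrib, ha', hb']
    · simp [ha'' e he, hb'' e he]
  smul_mem' := by
    rintro r a ⟨⟨ha, ha'⟩, ha''⟩
    refine ⟨⟨fun e => ?_, fun v => ?_⟩, fun e he => ?_⟩
    · simp [ha]
    · simp [← Finset.mul_sum, ha']
    · simp [ha'' e he]

theorem mem_cyclesOn {T : Set Γ.E} {c : Γ.E → ℝ} : c ∈ Γ.cyclesOn T ↔ Γ.IsCycleOn T c := Iff.rfl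

theorem mem_cyclesOn_empty {c : Γ.E → ℝ} : c ∈ Γ.cyclesOn ∅ ↔ Γ.IsCycle c := by
  simp [mem_cyclesOn, IsCycleOn]

theorem b1Sub_eq (T : Set Γ.E) : Γ.b1Sub T = Module.finrank ℝ (Γ.cyclesOn T) := by
  have : {c : Γ.E → ℝ | Γ.IsCycleOn T c} = (Γ.cyclesOn T : Set (Γ.E → ℝ)) := rfl
  rw [b1Sub, this, Submodule.span_eq]

theorem b1_eq : Γ.b1 = Module.finrank ℝ (Γ.cyclesOn ∅) := by
  have : {c : Γ.E → ℝ | Γ.IsCycle c} = (Γ.cyclesOn ∅ : Set (Γ.E → ℝ)) :=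
    Set.ext fun _ => Γ.mem_cyclesOn_empty.symm
  rw [b1, this, Submodule.span_eq]

variable {Γ}

theorem circChainR_eq {γ : Finset Γ.E} (hγ : ∀ e ∈ γ, Γ.inv e ∉ γ) (e : Γ.E) :
    Γ.circChainR γ e = (if e ∈ γ then 1 else 0) - (if Γ.inv e ∈ γ then 1 else 0) := by
  have := hγ e
  unfold circChainR circChainZ
  by_cases h1 : e ∈ γ <;> by_cases h2 : Γ.inv e ∈ γ <;> simp_all

theorem circChainR_inv {γ : Finset Γ.E} (hγ : ∀ e ∈ γ, Γ.inv e ∉ γ) (e : Γ.E) :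
    Γ.circChainR γ (Γ.inv e) = - Γ.circChainR γ e := by
  simp [circChainR_eq hγ, Γ.inv_inv]

theorem sum_circChainR {γ : Finset Γ.E} (hγ : ∀ e ∈ γ, Γ.inv e ∉ γ) (v : Γ.V) :
    ∑ e ∈ Finset.univ.filter (fun e => Γ.t e = v), Γ.circChainR γ e =
      ((γ.filter (fun e => Γ.t e = v)).card : ℝ) - (γ.filter (fun e => Γ.s e = v)).card := by
  simp only [circChainR_eq hγ, Finset.sum_sub_distrib, Finset.sum_boole]
  congr 2
  · congr 1
    ext e
    simp [and_comm]
  · refine Finset.card_bij' (fun e _ => Γ.inv e) (fun e _ => Γ.inv e) ?_ ?_ ?_ ?_ <;>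
      simp +contextual [Γ.inv_inv, Γ.t_inv, Γ.s_inv]

theorem IsCircuit.isCycle {γ : Finset Γ.E} (hγ : Γ.IsCircuit γ) : Γ.IsCycle (Γ.circChainR γ) := by
  obtain ⟨-, hinv, hs, ht, -⟩ := hγ
  refine ⟨circChainR_inv hinv, fun v => ?_⟩
  rw [sum_circChainR hinv]
  by_cases hv : v ∈ γ.image Γ.s ∪ γ.image Γ.t
  · have key : ∀ f : Γ.E → Γ.V, (∃! e, e ∈ γ ∧ f e = v) →
        (γ.filter (fun e => f e = v)).card = 1 := by
      rintro f ⟨e, he, hu⟩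
      refine Finset.card_eq_one.2 ⟨e, ?_⟩
      ext x
      simp only [Finset.mem_filter, Finset.mem_singleton]
      exact ⟨hu x, fun h => h ▸ he⟩
    rw [key _ (hs v hv), key _ (ht v hv), sub_self]
  · simp only [Finset.mem_union, Finset.mem_image, not_or, not_exists, not_and] at hv
    rw [Finset.filter_false_of_mem hv.1, Finset.filter_false_of_mem hv.2]
    simp

/-- A nonempty set of edges, each of which has a successor in the set, contains a circuit. -/
theorem exists_isCircuit {A : Set Γ.E} (hA : ∀ e ∈ A, Γ.inv e ∉ A) (hne : A.Nonempty)
    (hsucc : ∀ e ∈ A, ∃ f ∈ A, Γ.s f = Γ.t e) :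
    ∃ γ : Finset Γ.E, Γ.IsCircuit γ ∧ ∀ e ∈ γ, e ∈ A := by
  classical
  let X := {v : Γ.V // ∃ e ∈ A, Γ.t e = v}
  have hX : ∀ v : X, ∃ f ∈ A, Γ.s f = v.1 := by
    rintro ⟨v, e, he, rfl⟩
    exact hsucc e he
  choose out houtA hout using hX
  let g : X → X := fun v => ⟨Γ.t (out v), out v, houtA v, rfl⟩
  have hg : ∀ v, Γ.t (out v) = (g v).1 := fun _ => rfl
  obtain ⟨e₀, he₀⟩ := hne
  let x : X := ⟨Γ.t e₀, e₀, he₀, rfl⟩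
  obtain ⟨y, q, hyq⟩ : ∃ y, ∃ q, g^[q + 1] y = y := by
    obtain ⟨i, j, hij, h⟩ := Finite.exists_ne_map_eq_of_infinite (fun n : ℕ => g^[n] x)
    wlog hlt : i < j generalizing i j
    · exact this j i hij.symm h.symm (by omega)
    refine ⟨g^[i] x, j - i - 1, ?_⟩
    rw [← Function.iterate_add_apply, show j - i - 1 + 1 + i = j by omega]
    exact h.symm
  have hper : ∀ n j, g^[n + j * (q + 1)] y = g^[n] y := by
    intro n j
    have : Function.IsPeriodicPt g (q + 1) y := hyq
    rw [Function.iterate_add_apply, mul_comm, (this.mul_const j).eq]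
  have hstep : ∀ n, Γ.t (out (g^[n] y)) = (g^[n + 1] y).1 := fun n => by
    rw [hg, Function.iterate_succ_apply']
  have hinj : ∀ m n, g^[m + 1] y = g^[n + 1] y → g^[m] y = g^[n] y := by
    intro m n h
    have h' := congrArg g^[q] h
    rw [← Function.iterate_add_apply, ← Function.iterate_add_apply] at h'
    rwa [show q + (m + 1) = m + 1 * (q + 1) by ring,
      show q + (n + 1) = n + 1 * (q + 1) by ring, hper, hper] at h'
  let γ : Finset Γ.E := Finset.univ.filter (fun e => ∃ n, out (g^[n] y) = e)
  have hγ : ∀ e, e ∈ γ ↔ ∃ n, out (g^[n] y) = e := fun e => by simp [γ]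
  have hγA : ∀ e ∈ γ, e ∈ A := fun e he => by
    obtain ⟨n, rfl⟩ := (hγ e).1 he
    exact houtA _
  have hvert : ∀ v ∈ γ.image Γ.s ∪ γ.image Γ.t, ∃ n, (g^[n] y).1 = v := by
    intro v hv
    simp only [Finset.mem_union, Finset.mem_image] at hv
    rcases hv with ⟨e, he, rfl⟩ | ⟨e, he, rfl⟩ <;> obtain ⟨n, rfl⟩ := (hγ e).1 he
    · exact ⟨n, (hout _).symm⟩
    · exact ⟨n + 1, (hstep n).symm⟩
  refine ⟨γ, ⟨⟨out y, (hγ _).2 ⟨0, rfl⟩⟩, fun e he he' => hA e (hγA e he) (hγA _ he'),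
    ?_, ?_, ?_⟩, hγA⟩
  · intro v hv
    obtain ⟨n, rfl⟩ := hvert v hv
    refine ⟨out (g^[n] y), ⟨(hγ _).2 ⟨n, rfl⟩, hout _⟩, ?_⟩
    rintro e ⟨he, hes⟩
    obtain ⟨m, rfl⟩ := (hγ e).1 he
    rw [hout] at hes
    rw [Subtype.ext hes]
  · intro v hv
    obtain ⟨n, rfl⟩ := hvert v hv
    have hn : Γ.t (out (g^[n + q] y)) = (g^[n] y).1 := by
      rw [hstep, show n + q + 1 = n + 1 * (q + 1) by ring, hper]
    refine ⟨out (g^[n + q] y), ⟨(hγ _).2 ⟨_, rfl⟩, hn⟩, ?_⟩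
    rintro e ⟨he, het⟩
    obtain ⟨m, rfl⟩ := (hγ e).1 he
    rw [← hn, hstep, hstep] at het
    rw [hinj _ _ (Subtype.ext het)]
  · intro e he f hf
    obtain ⟨m, rfl⟩ := (hγ e).1 he
    obtain ⟨n, rfl⟩ := (hγ f).1 hf
    have hreach : ∀ k, Γ.Reach ((↑γ : Set Γ.E) ∪ Γ.inv '' ↑γ) (g^[m] y).1 (g^[m + k] y).1 := by
      intro k
      induction k with
      | zero => exact Relation.ReflTransGen.refl
      | succ k ih =>
        exact ih.tail ⟨out (g^[m + k] y), Or.inl ((hγ _).2 ⟨_, rfl⟩), hout _, hstep _⟩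
    have := hreach (n + m * q)
    rw [show m + (n + m * q) = n + m * (q + 1) by ring, hper] at this
    rwa [hout, hout]

variable {T O : Set Γ.E}

/-- A cycle that is nonnegative for the orientation `O` is a combination of directed circuits. -/
theorem mem_span_Cir_of_nonneg (hT : Γ.InvClosed T) (hO : Γ.IsOrientation T O) (k : Γ.E → ℝ)
    (hk : Γ.IsCycleOn T k) (hpos : ∀ e ∈ O, 0 ≤ k e) :
    k ∈ Submodule.span ℝ (Γ.circChainR '' Γ.Cir T O) := by
  induction hn : {e | e ∈ O ∧ 0 < k e}.ncard using Nat.strong_induction_on generalizing k with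
  | _ n ih =>
  have hinv : ∀ e, e ∉ T → e ∉ O → Γ.inv e ∈ O := fun e h1 h2 => by
    by_contra h
    exact h2 ((hO.2 e h1).2 h)
  have hinv' : ∀ e ∈ O, Γ.inv e ∉ O := fun e he => (hO.2 e (hO.1 e he)).1 he
  rcases {e | e ∈ O ∧ 0 < k e}.eq_empty_or_nonempty with hA | hA
  · have hz : ∀ e ∈ O, k e = 0 := fun e he => by
      refine le_antisymm (not_lt.1 fun h => ?_) (hpos e he)
      exact (hA ▸ (⟨he, h⟩ : e ∈ {e | e ∈ O ∧ 0 < k e}) : e ∈ (∅ : Set Γ.E))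
    have : k = 0 := by
      ext e
      by_cases heT : e ∈ T
      · exact hk.2 e heT
      by_cases heO : e ∈ O
      · exact hz e heO
      · have h1 := hz _ (hinv e heT heO)
        rw [hk.1.1] at h1
        exact neg_eq_zero.1 h1
    rw [this]
    exact Submodule.zero_mem _
  · obtain ⟨γ, hγ, hγA⟩ := exists_isCircuit (A := {e | e ∈ O ∧ 0 < k e})
      (fun e he he' => hinv' e he.1 he'.1) hA (by
        rintro e ⟨-, hke⟩
        obtain ⟨f, hf, hkf⟩ : ∃ f, Γ.t f = Γ.t e ∧ k f < 0 := by
          by_contra! hcon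
          have := Finset.sum_pos' (s := Finset.univ.filter (fun f => Γ.t f = Γ.t e)) (f := k)
            (fun f hf => hcon f (Finset.mem_filter.1 hf).2) ⟨e, by simp, hke⟩
          exact this.ne' (hk.1.2 _)
        have hfT : f ∉ T := fun h => hkf.ne (hk.2 f h)
        have hfO : f ∉ O := fun h => hkf.not_ge (hpos f h)
        refine ⟨Γ.inv f, ⟨hinv f hfT hfO, ?_⟩, (Γ.s_inv f).trans hf⟩
        rw [hk.1.1]
        linarith)
    have hγC : γ ∈ Γ.Cir T O := ⟨hγ, fun e he => (hγA e he).1, fun e he => hO.1 e (hγA e he).1⟩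
    have hval : ∀ e ∈ O, Γ.circChainR γ e = if e ∈ γ then 1 else 0 := fun e he => by
      rw [circChainR_eq hγ.2.1, if_neg (fun h => hinv' e he (hγA _ h).1), sub_zero]
    have hγT : ∀ e ∈ T, Γ.circChainR γ e = 0 := fun e he => by
      have h1 : e ∉ γ := fun h => hO.1 e (hγA e h).1 he
      have h2 : Γ.inv e ∉ γ := fun h => by
        have h3 := (hγA _ h).1
        exact hO.1 _ h3 ((hT e).1 he)
      simp [circChainR_eq hγ.2.1, h1, h2]
    obtain ⟨e₀, he₀, hmin⟩ := Finset.exists_min_image γ k hγ.1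
    let k' := k - k e₀ • Γ.circChainR γ
    have hk' : Γ.IsCycleOn T k' :=
      (Γ.cyclesOn T).sub_mem hk ((Γ.cyclesOn T).smul_mem _ ⟨hγ.isCycle, hγT⟩)
    have hk'e : ∀ e ∈ O, k' e = if e ∈ γ then k e - k e₀ else k e := fun e he => by
      simp only [k', Pi.sub_apply, Pi.smul_apply, smul_eq_mul, hval e he]
      split_ifs <;> ring
    have hpos' : ∀ e ∈ O, 0 ≤ k' e := fun e he => by
      rw [hk'e e he]
      split_ifs with h
      · exact sub_nonneg.2 (hmin e h)
      · exact hpos e he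
    have hlt : {e | e ∈ O ∧ 0 < k' e}.ncard < n := by
      rw [← hn]
      refine Set.ncard_lt_ncard ⟨?_, fun h => ?_⟩ (Set.toFinite _)
      · rintro e ⟨he, hke⟩
        by_cases heγ : e ∈ γ
        · exact hγA e heγ
        · rw [hk'e e he, if_neg heγ] at hke
          exact ⟨he, hke⟩
      · have := (h (hγA e₀ he₀)).2
        rw [hk'e e₀ (hγA e₀ he₀).1, if_pos he₀, sub_self] at this
        exact this.false
    have h1 := ih _ hlt k' hk' hpos' rfl
    have h2 : Γ.circChainR γ ∈ Submodule.span ℝ (Γ.circChainR '' Γ.Cir T O) :=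
      Submodule.subset_span ⟨γ, hγC, rfl⟩
    have h3 : k = k' + k e₀ • Γ.circChainR γ := by simp [k']
    rw [h3]
    exact Submodule.add_mem _ h1 (Submodule.smul_mem _ _ h2)

/-- A directed path carries a nonnegative flow from its start to its end. -/
theorem exists_flow_of_reach (hT : Γ.InvClosed T) (hO : Γ.IsOrientation T O) {a b : Γ.V}
    (h : Γ.Reach O a b) :
    ∃ c : Γ.E → ℝ, (∀ e, c (Γ.inv e) = - c e) ∧ (∀ e ∈ T, c e = 0) ∧ (∀ e ∈ O, 0 ≤ c e) ∧
      ∀ v, ∑ e ∈ Finset.univ.filter (fun e => Γ.t e = v), c e =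
        (if b = v then 1 else 0) - (if a = v then 1 else 0) := by
  induction h with
  | refl => exact ⟨0, by simp⟩
  | @tail b d _ hstep ih =>
    obtain ⟨e, he, rfl, rfl⟩ := hstep
    obtain ⟨c, h1, h2, h3, h4⟩ := ih
    have hsing : ∀ f ∈ ({e} : Finset Γ.E), Γ.inv f ∉ ({e} : Finset Γ.E) := by
      simp [Γ.inv_ne]
    refine ⟨c + Γ.circChainR {e}, fun f => ?_, fun f hf => ?_, fun f hf => ?_, fun v => ?_⟩
    · simp only [Pi.add_apply, h1, circChainR_inv hsing]
      ring
    · have hfe : f ≠ e := fun h => hO.1 e he (h ▸ hf)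
      have hfe' : Γ.inv f ≠ e := fun h => hO.1 e he (h ▸ (hT f).1 hf)
      simp [circChainR_eq hsing, h2 f hf, hfe, hfe']
    · have hfe' : Γ.inv f ≠ e := fun h => (hO.2 f (hO.1 f hf)).1 hf (h ▸ he)
      have := h3 f hf
      simp only [Pi.add_apply, circChainR_eq hsing, Finset.mem_singleton, if_neg hfe']
      split_ifs <;> linarith
    · simp only [Pi.add_apply, Finset.sum_add_distrib, h4, sum_circChainR hsing,
        Finset.filter_singleton]
      split_ifs <;> simp

theorem exists_cycle_pos (hT : Γ.InvClosed T) (hO : Γ.IsTotallyCyclic T O) {e : Γ.E}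
    (he : e ∈ O) :
    ∃ c : Γ.E → ℝ, Γ.IsCycleOn T c ∧ (∀ f ∈ O, 0 ≤ c f) ∧ 1 ≤ c e := by
  have hreach : Γ.Reach O (Γ.t e) (Γ.s e) := by
    by_contra hcon
    refine hO.2 ⟨{v | Γ.Reach O v (Γ.s e)}, ⟨Γ.s e, Relation.ReflTransGen.refl, Γ.t e, hcon,
      Relation.ReflTransGen.single ⟨e, hO.1.1 e he, rfl, rfl⟩⟩, fun f hf hft => ?_⟩
    exact Relation.ReflTransGen.head ⟨f, hf, rfl, rfl⟩ hft
  obtain ⟨c, h1, h2, h3, h4⟩ := exists_flow_of_reach hT hO.1 hreach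
  have hsing : ∀ f ∈ ({e} : Finset Γ.E), Γ.inv f ∉ ({e} : Finset Γ.E) := by
    simp [Γ.inv_ne]
  refine ⟨c + Γ.circChainR {e}, ⟨⟨fun f => ?_, fun v => ?_⟩, fun f hf => ?_⟩, fun f hf => ?_, ?_⟩
  · simp only [Pi.add_apply, h1, circChainR_inv hsing]
    ring
  · simp only [Pi.add_apply, Finset.sum_add_distrib, h4, sum_circChainR hsing,
      Finset.filter_singleton]
    split_ifs <;> simp
  · have hfe : f ≠ e := fun h => hO.1.1 e he (h ▸ hf)
    have hfe' : Γ.inv f ≠ e := fun h => hO.1.1 e he (h ▸ (hT f).1 hf)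
    simp [circChainR_eq hsing, h2 f hf, hfe, hfe']
  · have hfe' : Γ.inv f ≠ e := fun h => (hO.1.2 f (hO.1.1 f hf)).1 hf (h ▸ he)
    have := h3 f hf
    simp only [Pi.add_apply, circChainR_eq hsing, Finset.mem_singleton, if_neg hfe']
    split_ifs <;> linarith
  · simpa [circChainR_eq hsing, Γ.inv_ne] using h3 e he

theorem cyclesOn_le_span_Cir (hT : Γ.InvClosed T) (hO : Γ.IsTotallyCyclic T O) :
    Γ.cyclesOn T ≤ Submodule.span ℝ (Γ.circChainR '' Γ.Cir T O) := by
  classical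
  intro k hk
  choose! c hc hpos hone using fun e (he : e ∈ O) => exists_cycle_pos hT hO he
  let z := ∑ e ∈ Finset.univ.filter (· ∈ O), c e
  have hz : z ∈ Γ.cyclesOn T := Submodule.sum_mem _ fun e he => hc e (Finset.mem_filter.1 he).2
  have hz1 : ∀ e ∈ O, 1 ≤ z e := fun e he => by
    simp only [z, Finset.sum_apply]
    exact (hone e he).trans (Finset.single_le_sum (f := fun f => c f e)
      (fun f hf => hpos f (Finset.mem_filter.1 hf).2 e he) (by simpa using he))
  have hmem : ∀ x ∈ Γ.cyclesOn T, (∀ e ∈ O, 0 ≤ x e) →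
      x ∈ Submodule.span ℝ (Γ.circChainR '' Γ.Cir T O) := mem_span_Cir_of_nonneg hT hO.1
  have h1 := hmem z hz fun e he => zero_le_one.trans (hz1 e he)
  have h2 := hmem (k + (∑ e, |k e|) • z)
    (Submodule.add_mem _ hk (Submodule.smul_mem _ _ hz)) fun e he => by
      have h3 : |k e| ≤ ∑ e, |k e| :=
        Finset.single_le_sum (f := fun e => |k e|) (fun _ _ => abs_nonneg _) (Finset.mem_univ e)
      have h4 := neg_abs_le (k e)
      have h5 : (∑ e, |k e|) ≤ (∑ e, |k e|) * z e :=
        le_mul_of_one_le_right (Finset.sum_nonneg fun _ _ => abs_nonneg _) (hz1 e he)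
      simp only [Pi.add_apply, Pi.smul_apply, smul_eq_mul]
      linarith
  simpa using Submodule.sub_mem _ h2 (Submodule.smul_mem _ (∑ e, |k e|) h1)

/-- The projection to `H₁(Γ,ℝ)` of a chain in the cube `[-1/2, 1/2]^E` which is `1/2` on `O` lies
in the face `F(T,φ)`. -/
theorem mem_vorFace_of_dotProduct {c v : Γ.E → ℝ} (hv : Γ.IsCycle v)
    (hcv : ∀ h ∈ Γ.cyclesOn ∅, v ⬝ᵥ h = c ⬝ᵥ h) (hc : ∀ e, |c e| ≤ 1 / 2)
    (hcO : ∀ e ∈ O, c e = 1 / 2) (hcO' : ∀ e, Γ.inv e ∈ O → c e = - (1 / 2)) :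
    v ∈ Γ.vorFace T O := by
  refine ⟨⟨hv, fun l hl => ?_⟩, fun γ hγ => ?_⟩
  · have h1 : v ⬝ᵥ l ≤ l ⬝ᵥ l / 2 := by
      rw [hcv l (Γ.mem_cyclesOn_empty.2 hl.1), dotProduct, dotProduct, Finset.sum_div]
      refine Finset.sum_le_sum fun e _ => ?_
      obtain ⟨n, hn⟩ := hl.2 e
      have h2 : |l e| ≤ l e * l e := by
        rw [hn, ← abs_mul_abs_self]
        exact_mod_cast (sq |n| ▸ Int.le_self_sq |n| : |n| ≤ |n| * |n|)
      calc c e * l e ≤ |c e| * |l e| := (le_abs_self _).trans (abs_mul _ _).le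
        _ ≤ 1 / 2 * |l e| := by gcongr; exact hc e
        _ ≤ l e * l e / 2 := by linarith
    simp only [pair_eq_dotProduct, sub_dotProduct, dotProduct_sub, dotProduct_comm l v]
    linarith
  · obtain ⟨hγ, hγO, -⟩ := hγ
    rw [pair_eq_dotProduct, pair_eq_dotProduct, hcv _ (Γ.mem_cyclesOn_empty.2 hγ.isCycle)]
    congr 1
    rw [dotProduct, dotProduct, Finset.sum_div]
    refine Finset.sum_congr rfl fun e _ => ?_
    rw [circChainR_eq hγ.2.1]
    by_cases h1 : e ∈ γ
    · rw [hcO e (hγO e h1), if_pos h1, if_neg (hγ.2.1 e h1)]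
      norm_num
    · by_cases h2 : Γ.inv e ∈ γ
      · rw [hcO' e (hγO _ h2), if_neg h1, if_pos h2]
        norm_num
      · simp [h1, h2]

theorem mem_cyclesOn_of_dotProduct_vectorSpan (hT : Γ.InvClosed T) (hO : Γ.IsOrientation T O)
    {h : Γ.E → ℝ} (hh : Γ.IsCycle h)
    (hd : ∀ d ∈ vectorSpan ℝ (Γ.vorFace T O), d ⬝ᵥ h = 0) : Γ.IsCycleOn T h := by
  classical
  refine ⟨hh, fun e he => ?_⟩
  have heO : ∀ f ∈ O, f ≠ e := fun f hf hfe => hO.1 f hf (hfe ▸ he)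
  have heO' : ∀ f, Γ.inv f ∈ O → f ≠ e := fun f hf hfe => hO.1 _ hf ((hT f).1 (hfe ▸ he))
  let c : Γ.E → ℝ := fun f => if f ∈ O then 1 / 2 else if Γ.inv f ∈ O then - (1 / 2) else 0
  have hc : ∀ f, |c f| ≤ 1 / 2 := fun f => by
    simp only [c]
    split_ifs <;> norm_num
  have hcO : ∀ f ∈ O, c f = 1 / 2 := fun f hf => if_pos hf
  have hcO' : ∀ f, Γ.inv f ∈ O → c f = - (1 / 2) := fun f hf => by
    have : f ∉ O := fun h => (hO.2 f (hO.1 f h)).1 h hf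
    simp only [c, if_neg this, if_pos hf]
  have hce : c e = 0 := by
    simp only [c, if_neg fun h => heO e h rfl, if_neg fun h => heO' e h rfl]
  obtain ⟨v, hv, hvc⟩ := exists_mem_dotProduct_eq (Γ.cyclesOn ∅) c
  obtain ⟨w, hw, hwc⟩ := exists_mem_dotProduct_eq (Γ.cyclesOn ∅) (c + Pi.single e (1 / 2))
  have hvF : v ∈ Γ.vorFace T O :=
    mem_vorFace_of_dotProduct (Γ.mem_cyclesOn_empty.1 hv) hvc hc hcO hcO'
  have hwF : w ∈ Γ.vorFace T O := by
    refine mem_vorFace_of_dotProduct (Γ.mem_cyclesOn_empty.1 hw) hwc (fun f => ?_)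
      (fun f hf => ?_) (fun f hf => ?_)
    · rcases eq_or_ne f e with rfl | hf
      · simp [hce, abs_of_pos]
      · simpa [hf] using hc f
    · simpa [heO f hf] using hcO f hf
    · simpa [heO' f hf] using hcO' f hf
  have key := hd _ (vsub_mem_vectorSpan ℝ hwF hvF)
  have hmem := Γ.mem_cyclesOn_empty.2 hh
  rw [vsub_eq_sub, sub_dotProduct, hvc h hmem, hwc h hmem, add_dotProduct,
    add_sub_cancel_left, single_dotProduct] at key
  linarith

theorem dotProduct_eq_zero_of_mem_vectorSpan (hT : Γ.InvClosed T) (hO : Γ.IsTotallyCyclic T O)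
    {d k : Γ.E → ℝ} (hd : d ∈ vectorSpan ℝ (Γ.vorFace T O)) (hk : k ∈ Γ.cyclesOn T) :
    d ⬝ᵥ k = 0 := by
  have hk' := cyclesOn_le_span_Cir hT hO hk
  clear hk
  induction hd using Submodule.span_induction with
  | zero => simp
  | add x y _ _ hx hy => rw [add_dotProduct, hx, hy, add_zero]
  | smul r x _ hx => rw [smul_dotProduct, hx, smul_zero]
  | mem d hd =>
    obtain ⟨x, hx, y, hy, rfl⟩ := hd
    induction hk' using Submodule.span_induction with
    | zero => simp
    | add x y _ _ hx hy => rw [dotProduct_add, hx, hy, add_zero]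
    | smul r x _ hx => rw [dotProduct_smul, hx, smul_zero]
    | mem k hk =>
      obtain ⟨γ, hγ, rfl⟩ := hk
      have h1 := (hx.2 γ hγ).trans (hy.2 γ hγ).symm
      rw [pair_eq_dotProduct, pair_eq_dotProduct] at h1
      simp only [vsub_eq_sub, sub_dotProduct]
      linarith

theorem vectorSpan_vorFace_le : vectorSpan ℝ (Γ.vorFace T O) ≤ Γ.cyclesOn ∅ := by
  refine Submodule.span_le.2 ?_
  rintro _ ⟨x, hx, y, hy, rfl⟩
  exact Submodule.sub_mem _ (Γ.mem_cyclesOn_empty.2 hx.1.1) (Γ.mem_cyclesOn_empty.2 hy.1.1)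

end SerreGraph

/-- For `(T,φ) ∈ OP_Γ`, the dimension of the affine span of
the face `F(T,φ)` of the Voronoi polytope equals `b₁(Γ) − b₁(Γ∖T)`. -/
theorem stmt12 (Γ : SerreGraph) (p : Set Γ.E × Set Γ.E) (hp : p ∈ Γ.OP) :
    Module.finrank ℝ (affineSpan ℝ (Γ.vorFace p.1 p.2)).direction =
      Γ.b1 - Γ.b1Sub p.1 := by
  obtain ⟨hT, hO⟩ := hp
  rw [direction_affineSpan, SerreGraph.b1_eq, SerreGraph.b1Sub_eq]
  exact finrank_eq_sub_of_dotProduct SerreGraph.vectorSpan_vorFace_le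
    (fun k hk => Γ.mem_cyclesOn_empty.2 hk.1)
    (fun d hd k hk => SerreGraph.dotProduct_eq_zero_of_mem_vectorSpan hT hO hd hk)
    (fun h hh hd => SerreGraph.mem_cyclesOn_of_dotProduct_vectorSpan hT hO.1
      (Γ.mem_cyclesOn_empty.1 hh) hd)
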